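/- arXiv:2106.03539 — 4 statements merged into one kernel-verified Lean document; each statement's English description precedes it below -/
import Mathlib

section
/- For every n ≥ 1 and every complex square matrix A whose rows and columns are indexed by bit strings of length n, there exists a rate function r on the n-qubit system net such that the rate matrix of the resulting Quantum Petri net, with rows and columns indexed by its reachability set identified with the set {0,1}^n of bit strings, equals A. (Universality of QPNs: any quantum gate circuit operator matrix on n qubits is the rate matrix of a QPN.) -/
/-- A Place-Transition net: flow functions giving each transition its
input and output multiset of places. -/
structure PTN (P T : Type) where
  Fminus : T → Multiset P
  Fplus : T → Multiset P

namespace PTN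

variable {P T : Type} [DecidableEq P]

/-- Input flow of a concurrence (multiset of transitions), extended additively. -/
def inFlow (N : PTN P T) (t : Multiset T) : Multiset P := (t.map N.Fminus).sum

/-- Output flow of a concurrence, extended additively. -/
def outFlow (N : PTN P T) (t : Multiset T) : Multiset P := (t.map N.Fplus).sum

/-- `N.Fires m t m'` : concurrence `t` is enabled at marking `m` and firing it yields `m'`. -/
def Fires (N : PTN P T) (m : Multiset P) (t : Multiset T) (m' : Multiset P) : Prop :=
  N.inFlow t ≤ m ∧ m' = m - N.inFlow t + N.outFlow t

/-- Direct single-transition reachability: firing some concurrence of cardinality 1. -/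
def Step1 (N : PTN P T) (m m' : Multiset P) : Prop :=
  ∃ t : Multiset T, Multiset.card t = 1 ∧ N.Fires m t m'

/-- Reachability set of the system net `(N, M0)`. -/
def ReachSet (N : PTN P T) (M0 : Multiset P) : Set (Multiset P) :=
  {m | Relation.ReflTransGen N.Step1 M0 m}

/-- Entry `R_Q[m', m]` of the rate matrix: sum of `r m t` over all concurrences `t`
with `m →_t m'`. -/
noncomputable def rateEntry (N : PTN P T) (r : Multiset P → Multiset T → ℂ)
    (m m' : Multiset P) : ℂ :=
  ∑ᶠ t ∈ {t : Multiset T | N.Fires m t m'}, r m t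

end PTN

/-- The `n`-qubit net: places `(i, b)` for `i < n`, `b : Bool`; the transition `(i, b)`
moves the token of qubit `i` from `(i, b)` to `(i, !b)` (so `(i, false)` is `u_i` and
`(i, true)` is `d_i`). -/
def qubitNet (n : ℕ) : PTN (Fin n × Bool) (Fin n × Bool) where
  Fminus := fun t => {t}
  Fplus := fun t => {(t.1, !t.2)}

/-- The safe marking corresponding to the bit string `b : Fin n → Bool`. -/
def safeMarking {n : ℕ} (b : Fin n → Bool) : Multiset (Fin n × Bool) :=
  Finset.univ.val.map fun i => (i, b i)

theorem count_map_graph {n : ℕ} (s : Finset (Fin n)) (f : Fin n → Bool) (i : Fin n) (c : Bool) :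
    (s.val.map fun i => (i, f i)).count (i, c) = if i ∈ s ∧ f i = c then 1 else 0 := by
  have hnd : (s.val.map fun i => (i, f i)).Nodup :=
    s.nodup.map fun x y h => congrArg Prod.fst h
  rw [Multiset.count_eq_of_nodup hnd]
  congr 1
  simp only [Multiset.mem_map, Finset.mem_val, Prod.mk.injEq, eq_iff_iff]
  constructor
  · rintro ⟨j, hj, rfl, h⟩
    exact ⟨hj, h⟩
  · rintro ⟨hi, h⟩
    exact ⟨i, hi, rfl, h⟩

theorem count_safeMarking {n : ℕ} (b : Fin n → Bool) (i : Fin n) (c : Bool) :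
    (safeMarking b).count (i, c) = if b i = c then 1 else 0 := by
  rw [safeMarking, count_map_graph Finset.univ b i c]
  simp

theorem qubitNet_inFlow {n : ℕ} (t : Multiset (Fin n × Bool)) : (qubitNet n).inFlow t = t := by
  simp [PTN.inFlow, qubitNet]

theorem count_qubitNet_outFlow {n : ℕ} (t : Multiset (Fin n × Bool)) (i : Fin n) (c : Bool) :
    ((qubitNet n).outFlow t).count (i, c) = t.count (i, !c) := by
  have hmap : (qubitNet n).outFlow t = t.map fun p => (p.1, !p.2) := by
    have h := Multiset.sum_map_singleton (t.map fun p => (p.1, !p.2))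
    rwa [Multiset.map_map] at h
  have hinj : Function.Injective fun p : Fin n × Bool => (p.1, !p.2) := by
    rintro ⟨i, c⟩ ⟨j, d⟩ h
    simpa using h
  rw [hmap]
  simpa using Multiset.count_map_eq_count' _ t hinj (i, !c)

/-- The concurrence that flips exactly the qubits on which `b` and `b'` differ. -/
def flipConcurrence {n : ℕ} (b b' : Fin n → Bool) : Multiset (Fin n × Bool) :=
  (Finset.univ.filter fun i => b i ≠ b' i).val.map fun i => (i, b i)

theorem count_flipConcurrence {n : ℕ} (b b' : Fin n → Bool) (i : Fin n) (c : Bool) :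
    (flipConcurrence b b').count (i, c) = if b i ≠ b' i ∧ b i = c then 1 else 0 := by
  rw [flipConcurrence, count_map_graph]
  simp

theorem qubitNet_fires_safeMarking_iff {n : ℕ} (b b' : Fin n → Bool)
    (t : Multiset (Fin n × Bool)) :
    (qubitNet n).Fires (safeMarking b) t (safeMarking b') ↔ t = flipConcurrence b b' := by
  simp only [PTN.Fires, qubitNet_inFlow, Multiset.le_iff_count, Multiset.ext, Prod.forall,
    Multiset.count_add, Multiset.count_sub, count_qubitNet_outFlow, count_safeMarking,
    count_flipConcurrence]
  rw [← forall_and]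
  refine forall_congr' fun i => ?_
  simp only [Bool.forall_bool, Bool.not_true, Bool.not_false]
  generalize t.count (i, false) = x, t.count (i, true) = y
  cases b i <;> cases b' i <;>
    simp only [reduceCtorEq, if_true, if_false, ne_eq, not_true, not_false_eq_true, true_and,
      false_and] <;>
    omega

/-- The bit string read off from the places `(i, true)` of a marking. -/
def markingBits {n : ℕ} (m : Multiset (Fin n × Bool)) : Fin n → Bool :=
  fun i => decide ((i, true) ∈ m)

theorem markingBits_safeMarking {n : ℕ} (b : Fin n → Bool) : markingBits (safeMarking b) = b := by
  ext i
  simp [markingBits, safeMarking]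

/-- **Universality of QPNs.** For every `n ≥ 1` and every complex square matrix `A`
indexed by bit strings of length `n`, there is a rate function `r` on the `n`-qubit
system net (with initial marking `safeMarking (fun _ => false)`) whose rate matrix,
indexed by the reachability set identified with bit strings via `safeMarking`,
equals `A`. -/
theorem qpn_universality (n : ℕ) (hn : 1 ≤ n)
    (A : Matrix (Fin n → Bool) (Fin n → Bool) ℂ) :
    ∃ r : Multiset (Fin n × Bool) → Multiset (Fin n × Bool) → ℂ,
      ∀ b b' : Fin n → Bool,
        (qubitNet n).rateEntry r (safeMarking b) (safeMarking b') = A b' b := by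
  refine ⟨fun m t => A (markingBits (m - (qubitNet n).inFlow t + (qubitNet n).outFlow t))
    (markingBits m), fun b b' => ?_⟩
  have hset : {t | (qubitNet n).Fires (safeMarking b) t (safeMarking b')} =
      {flipConcurrence b b'} :=
    Set.ext fun t => qubitNet_fires_safeMarking_iff b b' t
  have hfire := (qubitNet_fires_safeMarking_iff b b' _).mpr rfl
  rw [PTN.rateEntry, hset, finsum_mem_singleton, ← hfire.2, markingBits_safeMarking,
    markingBits_safeMarking]
end

section
/- Kronecker product of QPNs: let Q = (S, r) and Q' = (S', r') be Quantum Petri nets with reachability sets R₀ and R₀'. Form the juxtaposition N ⊗ N' with initial marking M₀·M₀' and rate function r''_{m·m'}(t·t') = r_m(t)·r'_{m'}(t') for all m ∈ R₀, m' ∈ R₀' and concurrences t over T, t' over T'. Then, identifying the reachability set of the juxtaposition with R₀ × R₀', the rate matrix of the juxtaposed QPN satisfies R_{Q⊗Q'}[(m₂,m₂'), (m₁,m₁')] = R_Q[m₂,m₁] · R_{Q'}[m₂',m₁'] for all pairs; that is, R_{Q⊗Q'} is the Kronecker product R_Q ⊗ R_{Q'} of the component rate matrices. -/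
/-- Juxtaposition (disjoint parallel composition) of two PTNs. -/
def PTN.juxta {P T P' T' : Type} (N : PTN P T) (N' : PTN P' T') : PTN (P ⊕ P') (T ⊕ T') where
  Fminus := Sum.elim (fun t => (N.Fminus t).map Sum.inl) (fun t => (N'.Fminus t).map Sum.inr)
  Fplus := Sum.elim (fun t => (N.Fplus t).map Sum.inl) (fun t => (N'.Fplus t).map Sum.inr)

/-- The product `s·s'` of a multiset over `α` with a multiset over `β`, as a multiset
over `α ⊕ β`; used for markings and concurrences of a juxtaposition. -/
def mprod {α β : Type} (s : Multiset α) (s' : Multiset β) : Multiset (α ⊕ β) :=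
  s.map Sum.inl + s'.map Sum.inr

section mprod

variable {α β : Type}

theorem mprod_add (s t : Multiset α) (s' t' : Multiset β) :
    mprod (s + t) (s' + t') = mprod s s' + mprod t t' := by
  simp only [mprod, Multiset.map_add]
  abel

theorem mprod_surjective (u : Multiset (α ⊕ β)) :
    ∃ (s : Multiset α) (s' : Multiset β), mprod s s' = u := by
  induction u using Multiset.induction_on with
  | empty => exact ⟨0, 0, rfl⟩
  | cons x u ih =>
    obtain ⟨s, s', rfl⟩ := ih
    cases x with
    | inl a => exact ⟨a ::ₘ s, s', by simp [mprod]⟩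
    | inr b => exact ⟨s, b ::ₘ s', by simp [mprod]⟩

variable [DecidableEq α] [DecidableEq β]

@[simp]
theorem count_inl_mprod (s : Multiset α) (s' : Multiset β) (a : α) :
    (mprod s s').count (Sum.inl a) = s.count a := by
  rw [mprod, Multiset.count_add, Multiset.count_map_eq_count' _ _ Sum.inl_injective,
    add_eq_left]
  exact Multiset.count_eq_zero_of_notMem (by simp)

@[simp]
theorem count_inr_mprod (s : Multiset α) (s' : Multiset β) (b : β) :
    (mprod s s').count (Sum.inr b) = s'.count b := by
  rw [mprod, Multiset.count_add, Multiset.count_map_eq_count' _ _ Sum.inr_injective,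
    add_eq_right]
  exact Multiset.count_eq_zero_of_notMem (by simp)

theorem mprod_le_mprod {s t : Multiset α} {s' t' : Multiset β} :
    mprod s s' ≤ mprod t t' ↔ s ≤ t ∧ s' ≤ t' := by
  simp [Multiset.le_iff_count]

theorem mprod_sub (s t : Multiset α) (s' t' : Multiset β) :
    mprod (s - t) (s' - t') = mprod s s' - mprod t t' := by
  ext (a | b) <;> simp [Multiset.count_sub]

end mprod

theorem mprod_inj {α β : Type} {s t : Multiset α} {s' t' : Multiset β} :
    mprod s s' = mprod t t' ↔ s = t ∧ s' = t' := by
  classical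
  simp [Multiset.ext]

namespace PTN

variable {P T P' T' : Type}

theorem sum_map_elim_mprod (f : T → Multiset P) (f' : T' → Multiset P') (t : Multiset T)
    (t' : Multiset T') :
    ((mprod t t').map (Sum.elim (fun x => (f x).map Sum.inl) fun x => (f' x).map Sum.inr)).sum =
      mprod (t.map f).sum (t'.map f').sum := by
  simp only [mprod, Multiset.map_add, Multiset.sum_add, Multiset.map_map]
  congr 1
  · simpa [Multiset.map_map, Function.comp_def] using
      (map_multiset_sum (Multiset.mapAddMonoidHom Sum.inl) (t.map f)).symm
  · simpa [Multiset.map_map, Function.comp_def] using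
      (map_multiset_sum (Multiset.mapAddMonoidHom Sum.inr) (t'.map f')).symm

theorem juxta_inFlow_mprod (N : PTN P T) (N' : PTN P' T') (t : Multiset T) (t' : Multiset T') :
    (N.juxta N').inFlow (mprod t t') = mprod (N.inFlow t) (N'.inFlow t') :=
  sum_map_elim_mprod N.Fminus N'.Fminus t t'

theorem juxta_outFlow_mprod (N : PTN P T) (N' : PTN P' T') (t : Multiset T) (t' : Multiset T') :
    (N.juxta N').outFlow (mprod t t') = mprod (N.outFlow t) (N'.outFlow t') :=
  sum_map_elim_mprod N.Fplus N'.Fplus t t'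

variable [DecidableEq P] [DecidableEq P']

theorem juxta_fires_mprod (N : PTN P T) (N' : PTN P' T') (m₁ m₂ : Multiset P)
    (m₁' m₂' : Multiset P') (t : Multiset T) (t' : Multiset T') :
    (N.juxta N').Fires (mprod m₁ m₁') (mprod t t') (mprod m₂ m₂') ↔
      N.Fires m₁ t m₂ ∧ N'.Fires m₁' t' m₂' := by
  rw [Fires, juxta_inFlow_mprod, juxta_outFlow_mprod, ← mprod_sub, ← mprod_add, mprod_le_mprod,
    mprod_inj, Fires, Fires]
  tauto

theorem bijOn_mprod_fires (N : PTN P T) (N' : PTN P' T') (m₁ m₂ : Multiset P)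
    (m₁' m₂' : Multiset P') :
    Set.BijOn (fun p : Multiset T × Multiset T' => mprod p.1 p.2)
      ({t | N.Fires m₁ t m₂} ×ˢ {t' | N'.Fires m₁' t' m₂'})
      {u | (N.juxta N').Fires (mprod m₁ m₁') u (mprod m₂ m₂')} := by
  refine ⟨fun p hp => (juxta_fires_mprod ..).2 hp,
    fun p _ q _ h => Prod.ext_iff.2 (mprod_inj.1 h), fun u hu => ?_⟩
  obtain ⟨t, t', rfl⟩ := mprod_surjective u
  exact ⟨(t, t'), (juxta_fires_mprod ..).1 hu, rfl⟩

end PTN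

theorem finsum_mem_prod_mul {α β R : Type*} [NonUnitalNonAssocSemiring R] {s : Set α} {s' : Set β}
    (hs : s.Finite) (hs' : s'.Finite) (f : α → R) (g : β → R) :
    ∑ᶠ p ∈ s ×ˢ s', f p.1 * g p.2 = (∑ᶠ a ∈ s, f a) * ∑ᶠ b ∈ s', g b := by
  lift s to Finset α using hs
  lift s' to Finset β using hs'
  rw [← Finset.coe_product]
  simp only [finsum_mem_coe_finset]
  rw [Finset.sum_mul_sum, Finset.sum_product]

/-- **Kronecker product of QPNs.** Let `Q = (S, r)` and `Q' = (S', r')` be QPNs with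
reachability sets `R₀`, `R₀'`. Form the juxtaposition with initial marking `M₀·M₀'`
and rate function `r''_{m·m'}(t·t') = r_m(t)·r'_{m'}(t')`. Then, identifying the
reachability set of the juxtaposition with `R₀ × R₀'`, the rate matrix of the
juxtaposed QPN satisfies
`R_{Q⊗Q'}[(m₂,m₂'), (m₁,m₁')] = R_Q[m₂,m₁] · R_{Q'}[m₂',m₁']`,
i.e. it is the Kronecker product of the component rate matrices. -/
theorem rateMatrix_kroneckerProduct {P T P' T' : Type} [DecidableEq P] [DecidableEq P']
    (N : PTN P T) (N' : PTN P' T') (M0 : Multiset P) (M0' : Multiset P')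
    (hfin : ∀ m m' : Multiset P, {t : Multiset T | N.Fires m t m'}.Finite)
    (hfin' : ∀ m m' : Multiset P', {t' : Multiset T' | N'.Fires m t' m'}.Finite)
    (r : Multiset P → Multiset T → ℂ) (r' : Multiset P' → Multiset T' → ℂ)
    (r'' : Multiset (P ⊕ P') → Multiset (T ⊕ T') → ℂ)
    (hr'' : ∀ (m : Multiset P) (m' : Multiset P') (t : Multiset T) (t' : Multiset T'),
      r'' (mprod m m') (mprod t t') = r m t * r' m' t') :
    ∀ (m₁ m₂ : Multiset P) (m₁' m₂' : Multiset P'),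
      m₁ ∈ N.ReachSet M0 → m₂ ∈ N.ReachSet M0 →
      m₁' ∈ N'.ReachSet M0' → m₂' ∈ N'.ReachSet M0' →
      (N.juxta N').rateEntry r'' (mprod m₁ m₁') (mprod m₂ m₂')
        = N.rateEntry r m₁ m₂ * N'.rateEntry r' m₁' m₂' := by
  intro m₁ m₂ m₁' m₂' _ _ _ _
  rw [PTN.rateEntry, PTN.rateEntry, PTN.rateEntry,
    ← finsum_mem_prod_mul (hfin m₁ m₂) (hfin' m₁' m₂')]
  exact (finsum_mem_eq_of_bijOn _ (N.bijOn_mprod_fires N' m₁ m₂ m₁' m₂')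
    fun p _ => (hr'' m₁ m₁' p.1 p.2).symm).symm
end

section
/- In the n-qubit system net, every marking reachable from the initial marking M₀ = {P_{1,0}, …, P_{n,0}} by single-transition reachability is safe, and conversely every safe marking is reachable from M₀; hence the reachability set R₀ consists exactly of the 2^n safe markings and is in bijection with the set {0,1}^n of bit strings of length n. -/
theorem mem_safeMarking {n : ℕ} {b : Fin n → Bool} {p : Fin n × Bool} :
    p ∈ safeMarking b ↔ b p.1 = p.2 := by
  obtain ⟨i, c⟩ := p
  simp [safeMarking]

theorem safeMarking_injective {n : ℕ} : Function.Injective (safeMarking (n := n)) := by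
  intro b c h
  funext i
  have hi : (i, b i) ∈ safeMarking c := h ▸ mem_safeMarking.2 rfl
  exact (mem_safeMarking.1 hi).symm

theorem safeMarking_update {n : ℕ} (b : Fin n → Bool) (i : Fin n) (c : Bool) :
    safeMarking (Function.update b i c)
      = (i, c) ::ₘ (Finset.univ.val.erase i).map fun j => (j, b j) := by
  have hi : i ∈ (Finset.univ : Finset (Fin n)).val := Finset.mem_univ i
  unfold safeMarking
  conv_lhs => rw [← Multiset.cons_erase hi]
  rw [Multiset.map_cons, Function.update_self]
  congr 1
  refine Multiset.map_congr rfl fun j hj => ?_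
  rw [Function.update_of_ne ((Multiset.Nodup.mem_erase_iff Finset.univ.nodup).1 hj).1]

theorem safeMarking_erase {n : ℕ} (b : Fin n → Bool) (i : Fin n) :
    (safeMarking b).erase (i, b i) = (Finset.univ.val.erase i).map fun j => (j, b j) := by
  have h := safeMarking_update b i (b i)
  rw [Function.update_eq_self] at h
  rw [h, Multiset.erase_cons_head]

theorem qubitNet_step1_iff {n : ℕ} {m m' : Multiset (Fin n × Bool)} :
    (qubitNet n).Step1 m m' ↔ ∃ p ∈ m, m' = (p.1, !p.2) ::ₘ m.erase p := by
  simp only [PTN.Step1, Multiset.card_eq_one]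
  constructor
  · rintro ⟨_, ⟨p, rfl⟩, hle, rfl⟩
    refine ⟨p, by simpa [PTN.inFlow, qubitNet] using hle, ?_⟩
    simp [PTN.inFlow, PTN.outFlow, qubitNet, Multiset.sub_singleton,
      ← Multiset.singleton_add, add_comm]
  · rintro ⟨p, hp, rfl⟩
    refine ⟨{p}, ⟨p, rfl⟩, by simpa [PTN.inFlow, qubitNet] using hp, ?_⟩
    simp [PTN.inFlow, PTN.outFlow, qubitNet, Multiset.sub_singleton,
      ← Multiset.singleton_add, add_comm]

/-- From a safe marking, the possible single steps are exactly the flips of one qubit. -/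
theorem qubitNet_step1_safeMarking_iff {n : ℕ} {b : Fin n → Bool}
    {m : Multiset (Fin n × Bool)} :
    (qubitNet n).Step1 (safeMarking b) m
      ↔ ∃ i, m = safeMarking (Function.update b i (!b i)) := by
  rw [qubitNet_step1_iff]
  constructor
  · rintro ⟨⟨i, c⟩, hp, rfl⟩
    obtain rfl : b i = c := mem_safeMarking.1 hp
    exact ⟨i, by rw [safeMarking_update, safeMarking_erase]⟩
  · rintro ⟨i, rfl⟩
    exact ⟨(i, b i), mem_safeMarking.2 rfl, by rw [safeMarking_update, safeMarking_erase]⟩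

theorem safeMarking_update_reachable {n : ℕ} (b : Fin n → Bool) (i : Fin n) (c : Bool) :
    Relation.ReflTransGen (qubitNet n).Step1 (safeMarking b)
      (safeMarking (Function.update b i c)) := by
  by_cases h : c = b i
  · rw [h, Function.update_eq_self]
  · rw [Bool.eq_not.2 h]
    exact .single (qubitNet_step1_safeMarking_iff.2 ⟨i, rfl⟩)

theorem safeMarking_reachable {n : ℕ} (a b : Fin n → Bool) :
    Relation.ReflTransGen (qubitNet n).Step1 (safeMarking a) (safeMarking b) := by
  suffices h : ∀ s : Finset (Fin n), Relation.ReflTransGen (qubitNet n).Step1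
      (safeMarking a) (safeMarking (s.piecewise b a)) by
    simpa using h Finset.univ
  intro s
  induction s using Finset.induction_on with
  | empty => simpa using Relation.ReflTransGen.refl
  | insert i s _ ih =>
    rw [Finset.piecewise_insert]
    exact ih.trans (safeMarking_update_reachable _ i (b i))

theorem qubitNet_reachSet_safeMarking {n : ℕ} (a : Fin n → Bool) :
    (qubitNet n).ReachSet (safeMarking a) = Set.range (safeMarking (n := n)) := by
  ext m
  constructor
  · intro h
    change Relation.ReflTransGen _ _ _ at h
    induction h with
    | refl => exact ⟨a, rfl⟩
    | tail _ hstep ih =>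
      obtain ⟨b, rfl⟩ := ih
      obtain ⟨i, rfl⟩ := qubitNet_step1_safeMarking_iff.1 hstep
      exact ⟨_, rfl⟩
  · rintro ⟨b, rfl⟩
    exact safeMarking_reachable a b

/-- **Reachability set of the `n`-qubit net.** Every marking reachable from the initial
marking `M₀ = {P_{1,0}, …, P_{n,0}}` by single-transition reachability is safe, and
conversely every safe marking is reachable; hence the reachability set consists exactly
of the safe markings and is in bijection with `{0,1}^n` via `safeMarking` (which is
injective), so it has `2^n` elements. -/
theorem qubitNet_reachSet (n : ℕ) (hn : 1 ≤ n) :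
    (qubitNet n).ReachSet (safeMarking fun _ => false)
        = Set.range (safeMarking (n := n)) ∧
    Function.Injective (safeMarking (n := n)) ∧
    ((qubitNet n).ReachSet (safeMarking fun _ => false)).ncard = 2 ^ n := by
  refine ⟨qubitNet_reachSet_safeMarking _, safeMarking_injective, ?_⟩
  rw [qubitNet_reachSet_safeMarking, ← Set.image_univ,
    Set.ncard_image_of_injective _ safeMarking_injective, Set.ncard_univ]
  simp
end

section
/- Reachability set of a juxtaposition: let (N, M₀) and (N', M₀') be system PTNs with reachability sets R₀ and R₀'. Then the reachability set of the juxtaposed system net with initial marking M₀·M₀' equals { m·m' : m ∈ R₀, m' ∈ R₀' }; in particular it is in bijection with R₀ × R₀', so its cardinality is |R₀|·|R₀'| when both are finite. -/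
theorem mprod_injective {α β : Type} :
    Function.Injective (fun p : Multiset α × Multiset β => mprod p.1 p.2) := by
  have hnone {γ δ : Type} (s : Multiset γ) :
      s.filterMap (fun _ => (none : Option δ)) = 0 := by
    induction s using Multiset.induction <;> simp_all
  rintro ⟨a, b⟩ ⟨a', b'⟩ h
  have hl (s : Multiset α) (s' : Multiset β) : (mprod s s').filterMap Sum.getLeft? = s := by
    simp [mprod, Multiset.filterMap_map, Function.comp_def, hnone]
  have hr (s : Multiset α) (s' : Multiset β) : (mprod s s').filterMap Sum.getRight? = s' := by
    simp [mprod, Multiset.filterMap_map, Function.comp_def, hnone]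
  have h₁ := congrArg (Multiset.filterMap Sum.getLeft?) h
  have h₂ := congrArg (Multiset.filterMap Sum.getRight?) h
  simp only [hl, hr] at h₁ h₂
  rw [h₁, h₂]

theorem mprod_inj_s13 {α β : Type} {a a' : Multiset α} {b b' : Multiset β} :
    mprod a b = mprod a' b' ↔ a = a' ∧ b = b' :=
  ⟨fun h => Prod.mk.inj (mprod_injective (a₁ := (a, b)) (a₂ := (a', b')) h),
    fun h => by rw [h.1, h.2]⟩

theorem exists_eq_mprod {α β : Type} (s : Multiset (α ⊕ β)) : ∃ a b, s = mprod a b := by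
  induction s using Multiset.induction with
  | empty => exact ⟨0, 0, rfl⟩
  | cons x s ih =>
    obtain ⟨a, b, rfl⟩ := ih
    cases x with
    | inl x => exact ⟨x ::ₘ a, b, by simp [mprod]⟩
    | inr x => exact ⟨a, x ::ₘ b, by simp [mprod]⟩

theorem map_inl_add_mprod {α β : Type} (s a : Multiset α) (b : Multiset β) :
    s.map Sum.inl + mprod a b = mprod (s + a) b := by
  simp [mprod, add_assoc]

theorem map_inr_add_mprod {α β : Type} (s b : Multiset β) (a : Multiset α) :
    s.map Sum.inr + mprod a b = mprod a (s + b) := by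
  simp [mprod, add_left_comm]

namespace PTN

/-- A single transition replaces its input by its output inside a fixed context `c`. -/
theorem step1_iff {P T : Type} [DecidableEq P] (N : PTN P T) {m m' : Multiset P} :
    N.Step1 m m' ↔ ∃ t c, m = N.Fminus t + c ∧ m' = N.Fplus t + c := by
  constructor
  · rintro ⟨t, ht, hle, rfl⟩
    obtain ⟨t, rfl⟩ := Multiset.card_eq_one.mp ht
    simp only [inFlow, outFlow, Multiset.map_singleton, Multiset.sum_singleton] at hle ⊢
    exact ⟨t, m - N.Fminus t, (add_tsub_cancel_of_le hle).symm, add_comm _ _⟩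
  · rintro ⟨t, c, rfl, rfl⟩
    refine ⟨{t}, Multiset.card_singleton t, ?_⟩
    simp [Fires, inFlow, outFlow, add_comm]

variable {P T P' T' : Type} [DecidableEq P] [DecidableEq P'] (N : PTN P T) (N' : PTN P' T')

theorem juxta_step1_iff {m : Multiset P} {m' : Multiset P'} {x : Multiset (P ⊕ P')} :
    (N.juxta N').Step1 (mprod m m') x ↔
      (∃ n, N.Step1 m n ∧ x = mprod n m') ∨ ∃ n', N'.Step1 m' n' ∧ x = mprod m n' := by
  simp only [step1_iff]
  constructor
  · rintro ⟨t, c, hm, rfl⟩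
    obtain ⟨a, b, rfl⟩ := exists_eq_mprod c
    cases t with
    | inl t =>
      simp only [juxta, Sum.elim_inl, map_inl_add_mprod, mprod_inj_s13] at hm ⊢
      exact Or.inl ⟨_, ⟨t, a, hm.1, rfl⟩, rfl, hm.2.symm⟩
    | inr t =>
      simp only [juxta, Sum.elim_inr, map_inr_add_mprod, mprod_inj_s13] at hm ⊢
      exact Or.inr ⟨_, ⟨t, b, hm.2, rfl⟩, hm.1.symm, rfl⟩
  · rintro (⟨_, ⟨t, c, rfl, rfl⟩, rfl⟩ | ⟨_, ⟨t, c, rfl, rfl⟩, rfl⟩)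
    · exact ⟨Sum.inl t, mprod c m', by simp [juxta, map_inl_add_mprod]⟩
    · exact ⟨Sum.inr t, mprod m c, by simp [juxta, map_inr_add_mprod]⟩

theorem juxta_reachSet_eq_image (M0 : Multiset P) (M0' : Multiset P') :
    (N.juxta N').ReachSet (mprod M0 M0')
      = (fun p : Multiset P × Multiset P' => mprod p.1 p.2) ''
          (N.ReachSet M0 ×ˢ N'.ReachSet M0') := by
  ext x
  constructor
  · intro hx
    change Relation.ReflTransGen _ _ _ at hx
    induction hx with
    | refl => exact ⟨(M0, M0'), ⟨.refl, .refl⟩, rfl⟩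
    | tail _ hstep ih =>
      obtain ⟨⟨m, m'⟩, ⟨hm, hm'⟩, rfl⟩ := ih
      obtain ⟨n, hn, rfl⟩ | ⟨n', hn', rfl⟩ := (juxta_step1_iff N N').mp hstep
      · exact ⟨(n, m'), ⟨.tail hm hn, hm'⟩, rfl⟩
      · exact ⟨(m, n'), ⟨hm, .tail hm' hn'⟩, rfl⟩
  · rintro ⟨⟨m, m'⟩, ⟨hm, hm'⟩, rfl⟩
    exact (Relation.ReflTransGen.lift (fun n => mprod n M0')
      (fun _ n h => (juxta_step1_iff N N').mpr (.inl ⟨n, h, rfl⟩)) _ _ hm).trans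
      (Relation.ReflTransGen.lift (fun n' => mprod m n')
        (fun _ n' h => (juxta_step1_iff N N').mpr (.inr ⟨n', h, rfl⟩)) _ _ hm')

end PTN

/-- **Reachability set of a juxtaposition.** The reachability set of the juxtaposed
system net with initial marking `M₀·M₀'` equals `{ m·m' : m ∈ R₀, m' ∈ R₀' }`; since
the pairing map is injective, it is in bijection with `R₀ × R₀'`, so its cardinality
is `|R₀|·|R₀'|` when both component reachability sets are finite. -/
theorem juxta_reachSet {P T P' T' : Type} [DecidableEq P] [DecidableEq P']
    (N : PTN P T) (N' : PTN P' T') (M0 : Multiset P) (M0' : Multiset P') :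
    (N.juxta N').ReachSet (mprod M0 M0')
        = (fun p : Multiset P × Multiset P' => mprod p.1 p.2) ''
            (N.ReachSet M0 ×ˢ N'.ReachSet M0') ∧
    Function.Injective (fun p : Multiset P × Multiset P' => mprod p.1 p.2) ∧
    ((N.ReachSet M0).Finite → (N'.ReachSet M0').Finite →
      ((N.juxta N').ReachSet (mprod M0 M0')).ncard
        = (N.ReachSet M0).ncard * (N'.ReachSet M0').ncard) := by
  refine ⟨N.juxta_reachSet_eq_image N' M0 M0', mprod_injective, fun _ _ => ?_⟩
  rw [N.juxta_reachSet_eq_image N' M0 M0', Set.ncard_image_of_injective _ mprod_injective,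
    Set.ncard_prod]
end
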